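/- arXiv:2403.17435 — 4 statements merged into one kernel-verified Lean document; each statement's English description precedes it below -/
import Mathlib

section
/- Let 𝕜 be a field, V and W vector spaces over 𝕜, ι an arbitrary index set, and {V_j}_{j∈ι} a family of subspaces of V. Then ⨅_{j∈ι} (V_j ⊗ W) = (⨅_{j∈ι} V_j) ⊗ W, where for a subspace V' ≤ V, the symbol V' ⊗ W denotes the image in V ⊗[𝕜] W of the canonical map V' ⊗[𝕜] W → V ⊗[𝕜] W induced by the inclusion V' ↪ V and the identity on W. -/
open scoped TensorProduct in
/-- A tensor lies in the image of `V' ⊗ W` iff its coordinates with respect to a basis of `W`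
all lie in `V'`. -/
theorem TensorProduct.mem_range_mapIncl_top_iff {R M N κ : Type*} [CommRing R]
    [AddCommGroup M] [Module R M] [AddCommGroup N] [Module R N] [DecidableEq κ]
    (b : Module.Basis κ R N) (p : Submodule R M) (x : M ⊗[R] N) :
    x ∈ LinearMap.range (TensorProduct.mapIncl p (⊤ : Submodule R N)) ↔
      ∀ i, TensorProduct.equivFinsuppOfBasisRight b x i ∈ p := by
  constructor
  · rintro ⟨y, rfl⟩ i
    induction y with
    | zero => simp
    | tmul m n =>
      simpa [TensorProduct.mapIncl] using p.smul_mem _ m.2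
    | add y z hy hz =>
      simpa using p.add_mem hy hz
  · intro h
    rw [← (TensorProduct.equivFinsuppOfBasisRight b).symm_apply_apply x,
      TensorProduct.equivFinsuppOfBasisRight_symm_apply]
    exact Submodule.sum_mem _ fun i _ => ⟨⟨_, h i⟩ ⊗ₜ ⟨b i, trivial⟩, rfl⟩

/-- **Lemma (tensoring with a fixed space distributes over intersection).**
Let `𝕜` be a field, `V`, `W` vector spaces over `𝕜`, `ι` an arbitrary index set and
`{Vj j}` a family of subspaces of `V`.  Identifying a subspace `V' ≤ V` with the image
`V' ⊗ W := range (TensorProduct.mapIncl V' ⊤)` inside `V ⊗[𝕜] W`, one has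
`⨅ j, (Vj j ⊗ W) = (⨅ j, Vj j) ⊗ W`. -/
theorem iInf_tensor_right_eq
    {𝕜 V W : Type*} [Field 𝕜] [AddCommGroup V] [Module 𝕜 V]
    [AddCommGroup W] [Module 𝕜 W] {ι : Type*} (Vj : ι → Submodule 𝕜 V) :
    (⨅ j, LinearMap.range (TensorProduct.mapIncl (Vj j) (⊤ : Submodule 𝕜 W))) =
      LinearMap.range (TensorProduct.mapIncl (⨅ j, Vj j) (⊤ : Submodule 𝕜 W)) := by
  classical
  ext x
  simp only [Submodule.mem_iInf,
    TensorProduct.mem_range_mapIncl_top_iff (Module.Basis.ofVectorSpace 𝕜 W)]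
  exact forall_comm
end

section
/- Let H_A be a finite-dimensional complex vector space and H_B a finite-dimensional complex inner product space. Let Φ be a nonempty set of linear functionals on H_A and let ψ be a single linear functional on H_B. Set K_A = ⋂_{φ∈Φ} ker(φ). Then ⋂_{φ∈Φ} ker(φ ⊗ ψ) = (H_A ⊗ ker ψ) ⊔ (K_A ⊗ (ker ψ)ᗮ), and this sum is direct, i.e. (H_A ⊗ ker ψ) ⊓ (K_A ⊗ (ker ψ)ᗮ) = {0}. (This is the linear-algebraic content of the kernel of the map restricting holomorphic sections of L₁ ⊠ L₂ → M₁ × M₂ to a product subset Λ₁ × {y}: in a local trivialization, evaluation of a section at a point (x,y) is a functional of the form φ_x ⊗ ψ_y, since the fibers of the line bundles are one-dimensional.) -/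
open TensorProduct

/-- The functional `φ ⊗ ψ` on `H_A ⊗[ℂ] H_B`: the unique linear map with
`(φ ⊗ ψ)(u ⊗ v) = φ(u) * ψ(v)`. -/
noncomputable def tensorFunctional {HA HB : Type*}
    [AddCommGroup HA] [Module ℂ HA] [AddCommGroup HB] [Module ℂ HB]
    (φ : HA →ₗ[ℂ] ℂ) (ψ : HB →ₗ[ℂ] ℂ) : HA ⊗[ℂ] HB →ₗ[ℂ] ℂ :=
  TensorProduct.lift (φ.smulRight ψ)

/-- The contraction `u ⊗ v ↦ ψ v • u`. -/
noncomputable def tensorContractRight (HA : Type*) {HB : Type*}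
    [AddCommGroup HA] [Module ℂ HA] [AddCommGroup HB] [Module ℂ HB]
    (ψ : HB →ₗ[ℂ] ℂ) : HA ⊗[ℂ] HB →ₗ[ℂ] HA :=
  (TensorProduct.rid ℂ HA).toLinearMap ∘ₗ ψ.lTensor HA

section

variable {HA HB : Type*} [AddCommGroup HA] [Module ℂ HA] [AddCommGroup HB] [Module ℂ HB]

@[simp]
lemma tensorContractRight_tmul (ψ : HB →ₗ[ℂ] ℂ) (u : HA) (v : HB) :
    tensorContractRight HA ψ (u ⊗ₜ v) = ψ v • u := by
  simp [tensorContractRight]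

lemma tensorFunctional_eq_comp (φ : HA →ₗ[ℂ] ℂ) (ψ : HB →ₗ[ℂ] ℂ) :
    tensorFunctional φ ψ = φ ∘ₗ tensorContractRight HA ψ := by
  ext u v
  simp [tensorFunctional, mul_comm]

lemma tmul_mem_range_mapIncl {P : Submodule ℂ HA} {Q : Submodule ℂ HB} {u : HA} {v : HB}
    (hu : u ∈ P) (hv : v ∈ Q) : u ⊗ₜ[ℂ] v ∈ LinearMap.range (TensorProduct.mapIncl P Q) :=
  ⟨(⟨u, hu⟩ : P) ⊗ₜ (⟨v, hv⟩ : Q), by simp [TensorProduct.mapIncl]⟩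

lemma tensorContractRight_eq_zero_of_mem {P : Submodule ℂ HA} {ψ : HB →ₗ[ℂ] ℂ} {t : HA ⊗[ℂ] HB}
    (ht : t ∈ LinearMap.range (TensorProduct.mapIncl P (LinearMap.ker ψ))) :
    tensorContractRight HA ψ t = 0 := by
  obtain ⟨s, rfl⟩ := ht
  induction s with
  | zero => simp
  | add x y hx hy => simp [hx, hy]
  | tmul u v => simp [TensorProduct.mapIncl]

lemma tensorContractRight_mem {P : Submodule ℂ HA} {Q : Submodule ℂ HB} (ψ : HB →ₗ[ℂ] ℂ)
    {t : HA ⊗[ℂ] HB} (ht : t ∈ LinearMap.range (TensorProduct.mapIncl P Q)) :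
    tensorContractRight HA ψ t ∈ P := by
  obtain ⟨s, rfl⟩ := ht
  induction s with
  | zero => simp
  | add x y hx hy => simpa using P.add_mem hx hy
  | tmul u v => simpa [TensorProduct.mapIncl] using P.smul_mem _ u.2

lemma sub_tensorContractRight_tmul_mem {ψ : HB →ₗ[ℂ] ℂ} {w : HB}
    (hw : ∀ v, v - ψ v • w ∈ LinearMap.ker ψ) (t : HA ⊗[ℂ] HB) :
    t - tensorContractRight HA ψ t ⊗ₜ w ∈
      LinearMap.range (TensorProduct.mapIncl (⊤ : Submodule ℂ HA) (LinearMap.ker ψ)) := by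
  induction t with
  | zero => simp
  | add x y hx hy =>
    convert Submodule.add_mem _ hx hy using 1
    rw [map_add, TensorProduct.add_tmul]
    abel
  | tmul u v =>
    convert tmul_mem_range_mapIncl (Submodule.mem_top : u ∈ (⊤ : Submodule ℂ HA)) (hw v) using 1
    rw [tensorContractRight_tmul, TensorProduct.tmul_sub, TensorProduct.smul_tmul]

lemma eq_tensorContractRight_tmul {P : Submodule ℂ HA} {Q : Submodule ℂ HB} {ψ : HB →ₗ[ℂ] ℂ}
    {w : HB} (hw : ∀ v ∈ Q, v = ψ v • w) {t : HA ⊗[ℂ] HB}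
    (ht : t ∈ LinearMap.range (TensorProduct.mapIncl P Q)) :
    t = tensorContractRight HA ψ t ⊗ₜ w := by
  obtain ⟨s, rfl⟩ := ht
  induction s with
  | zero => simp
  | add x y hx hy => rw [map_add, map_add, TensorProduct.add_tmul, ← hx, ← hy]
  | tmul u v =>
    simp only [TensorProduct.mapIncl, TensorProduct.map_tmul, Submodule.subtype_apply,
      tensorContractRight_tmul, TensorProduct.smul_tmul]
    rw [← hw v v.2]

lemma exists_mem_sub_smul_mem_ker {ψ : HB →ₗ[ℂ] ℂ} {Q : Submodule ℂ HB}
    (h : IsCompl (LinearMap.ker ψ) Q) :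
    ∃ w ∈ Q, ∀ v, v - ψ v • w ∈ LinearMap.ker ψ := by
  by_cases hψ : ψ = 0
  · exact ⟨0, Q.zero_mem, by simp [hψ]⟩
  obtain ⟨u, hu⟩ : ∃ u, ψ u ≠ 0 := by
    by_contra! hzero
    exact hψ (LinearMap.ext hzero)
  obtain ⟨a, ha, b, hb, rfl⟩ := Submodule.mem_sup.1 (h.sup_eq_top ▸ Submodule.mem_top : u ∈ _)
  rw [LinearMap.mem_ker] at ha
  rw [map_add, ha, zero_add] at hu
  exact ⟨(ψ b)⁻¹ • b, Q.smul_mem _ hb, fun v => by simp [hu]⟩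

end

/-- **Kernel of the restriction map to `Λ₁ × {y}` (linear-algebraic form).**
With `H_A` a finite-dimensional complex vector space, `H_B` a finite-dimensional complex
inner product space, `Φ` a nonempty set of functionals on `H_A`, `ψ` a functional on `H_B`,
and `K_A = ⋂_{φ ∈ Φ} ker φ`, one has
`⋂_{φ ∈ Φ} ker (φ ⊗ ψ) = (H_A ⊗ ker ψ) ⊔ (K_A ⊗ (ker ψ)ᗮ)`, a direct sum. -/
theorem ker_tensorFunctional_singleton
    {HA HB : Type*} [AddCommGroup HA] [Module ℂ HA] [FiniteDimensional ℂ HA]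
    [NormedAddCommGroup HB] [InnerProductSpace ℂ HB] [FiniteDimensional ℂ HB]
    (Φ : Set (HA →ₗ[ℂ] ℂ)) (hΦ : Φ.Nonempty) (ψ : HB →ₗ[ℂ] ℂ)
    (KA : Submodule ℂ HA) (hKA : KA = ⨅ φ ∈ Φ, LinearMap.ker φ) :
    (⨅ φ ∈ Φ, LinearMap.ker (tensorFunctional φ ψ)) =
        LinearMap.range (TensorProduct.mapIncl (⊤ : Submodule ℂ HA) (LinearMap.ker ψ)) ⊔
          LinearMap.range (TensorProduct.mapIncl KA (LinearMap.ker ψ)ᗮ) ∧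
      LinearMap.range (TensorProduct.mapIncl (⊤ : Submodule ℂ HA) (LinearMap.ker ψ)) ⊓
          LinearMap.range (TensorProduct.mapIncl KA (LinearMap.ker ψ)ᗮ) = ⊥ := by
  obtain ⟨w, hwQ, hw⟩ := exists_mem_sub_smul_mem_ker
    (Submodule.isCompl_orthogonal (K := LinearMap.ker ψ))
  have hw' : ∀ v ∈ (LinearMap.ker ψ)ᗮ, v = ψ v • w := fun v hv =>
    sub_eq_zero.1 <| Submodule.disjoint_def.1 (LinearMap.ker ψ).orthogonal_disjoint _ (hw v)
      (Submodule.sub_mem _ hv (Submodule.smul_mem _ _ hwQ))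
  have hker : ∀ t, t ∈ (⨅ φ ∈ Φ, LinearMap.ker (tensorFunctional φ ψ)) ↔
      tensorContractRight HA ψ t ∈ KA := fun t => by
    simp [hKA, Submodule.mem_iInf, tensorFunctional_eq_comp]
  refine ⟨le_antisymm (fun t ht => ?_) (sup_le (fun t ht => ?_) fun t ht => ?_), ?_⟩
  · exact Submodule.mem_sup.2 ⟨_, sub_tensorContractRight_tmul_mem hw t, _,
      tmul_mem_range_mapIncl ((hker t).1 ht) hwQ, sub_add_cancel _ _⟩
  · rw [hker, tensorContractRight_eq_zero_of_mem ht]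
    exact KA.zero_mem
  · exact (hker t).2 (tensorContractRight_mem ψ ht)
  · refine (Submodule.eq_bot_iff _).2 fun t ht => ?_
    rw [eq_tensorContractRight_tmul hw' ht.2, tensorContractRight_eq_zero_of_mem ht.1,
      TensorProduct.zero_tmul]
end

section
/- Let H_A be a finite-dimensional complex vector space and H_B a finite-dimensional complex inner product space. Let Φ be a nonempty set of linear functionals on H_A and Ψ a nonempty set of linear functionals on H_B. Set K_A = ⋂_{φ∈Φ} ker(φ) and K_B = ⋂_{ψ∈Ψ} ker(ψ). Then ⋂_{φ∈Φ, ψ∈Ψ} ker(φ ⊗ ψ) = (H_A ⊗ K_B) ⊔ (K_A ⊗ K_Bᗮ), and this sum is direct, i.e. (H_A ⊗ K_B) ⊓ (K_A ⊗ K_Bᗮ) = {0}. (This is the linear-algebraic content of the kernel of the map restricting holomorphic sections of L₁ ⊠ L₂ → M₁ × M₂ to an arbitrary product subset Λ₁ × Λ₂: in a local trivialization, evaluation of a section at a point (x,y) is a functional of the form φ_x ⊗ ψ_y, since the fibers of the line bundles are one-dimensional.) -/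
open TensorProduct

theorem tensorFunctional_tmul {HA HB : Type*} [AddCommGroup HA] [Module ℂ HA]
    [AddCommGroup HB] [Module ℂ HB] (φ : HA →ₗ[ℂ] ℂ) (ψ : HB →ₗ[ℂ] ℂ) (u : HA) (v : HB) :
    tensorFunctional φ ψ (u ⊗ₜ v) = φ u * ψ v := by
  simp [tensorFunctional]

theorem tensorFunctional_map {HA HB : Type*} [AddCommGroup HA] [Module ℂ HA]
    [AddCommGroup HB] [Module ℂ HB] (φ : HA →ₗ[ℂ] ℂ) (ψ : HB →ₗ[ℂ] ℂ)
    (f : HA →ₗ[ℂ] HA) (g : HB →ₗ[ℂ] HB) (z : HA ⊗[ℂ] HB) :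
    tensorFunctional φ ψ (TensorProduct.map f g z) =
      tensorFunctional (φ ∘ₗ f) (ψ ∘ₗ g) z := by
  induction z with
  | zero => simp
  | tmul x y => simp [tensorFunctional_tmul]
  | add x y hx hy => simp [hx, hy]

/-- The functionals `φ ⊗ ψ` separate the points of the tensor product. -/
theorem eq_zero_of_forall_tensorFunctional {HA HB : Type*} [AddCommGroup HA] [Module ℂ HA]
    [AddCommGroup HB] [Module ℂ HB] (z : HA ⊗[ℂ] HB)
    (h : ∀ φ ψ, tensorFunctional φ ψ z = 0) : z = 0 := by
  let b := Module.Basis.ofVectorSpace ℂ HA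
  let c := Module.Basis.ofVectorSpace ℂ HB
  refine (b.tensorProduct c).ext_elem fun i => ?_
  have key : (b.tensorProduct c).coord i = tensorFunctional (b.coord i.1) (c.coord i.2) := by
    ext x y
    simpa [tensorFunctional_tmul, mul_comm] using
      b.tensorProduct_repr_tmul_apply c x y i.1 i.2
  simpa using (DFunLike.congr_fun key z).trans (h _ _)

theorem mem_span_of_iInf_ker_le {V : Type*} [AddCommGroup V] [Module ℂ V]
    [FiniteDimensional ℂ V] (Φ : Set (V →ₗ[ℂ] ℂ)) (α : V →ₗ[ℂ] ℂ)
    (h : ⨅ φ ∈ Φ, LinearMap.ker φ ≤ LinearMap.ker α) : α ∈ Submodule.span ℂ Φ := by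
  rw [← Subspace.dualCoannihilator_dualAnnihilator_eq (W := Submodule.span ℂ Φ),
    Submodule.mem_dualAnnihilator]
  intro x hx
  refine h ?_
  simp only [Submodule.mem_iInf, LinearMap.mem_ker]
  exact fun φ hφ => (Submodule.mem_dualCoannihilator x).1 hx φ (Submodule.subset_span hφ)

theorem tensorFunctional_eq_zero_of_mem_span {HA HB : Type*} [AddCommGroup HA] [Module ℂ HA]
    [AddCommGroup HB] [Module ℂ HB] {Φ : Set (HA →ₗ[ℂ] ℂ)} {Ψ : Set (HB →ₗ[ℂ] ℂ)}
    {z : HA ⊗[ℂ] HB} (hz : ∀ φ ∈ Φ, ∀ ψ ∈ Ψ, tensorFunctional φ ψ z = 0)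
    {α : HA →ₗ[ℂ] ℂ} {β : HB →ₗ[ℂ] ℂ} (hα : α ∈ Submodule.span ℂ Φ)
    (hβ : β ∈ Submodule.span ℂ Ψ) : tensorFunctional α β z = 0 := by
  have smul_left (a : ℂ) (φ : HA →ₗ[ℂ] ℂ) (ψ : HB →ₗ[ℂ] ℂ) :
      tensorFunctional (a • φ) ψ = a • tensorFunctional φ ψ := by
    ext; simp [tensorFunctional_tmul, mul_assoc]
  have smul_right (a : ℂ) (φ : HA →ₗ[ℂ] ℂ) (ψ : HB →ₗ[ℂ] ℂ) :
      tensorFunctional φ (a • ψ) = a • tensorFunctional φ ψ := by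
    ext; simp [tensorFunctional_tmul, mul_left_comm]
  have add_left (φ φ' : HA →ₗ[ℂ] ℂ) (ψ : HB →ₗ[ℂ] ℂ) :
      tensorFunctional (φ + φ') ψ = tensorFunctional φ ψ + tensorFunctional φ' ψ := by
    ext; simp [tensorFunctional_tmul, add_mul]
  have add_right (φ : HA →ₗ[ℂ] ℂ) (ψ ψ' : HB →ₗ[ℂ] ℂ) :
      tensorFunctional φ (ψ + ψ') = tensorFunctional φ ψ + tensorFunctional φ ψ' := by
    ext; simp [tensorFunctional_tmul, mul_add]
  induction hα, hβ using Submodule.span_induction₂ with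
  | mem_mem φ ψ hφ hψ => exact hz φ hφ ψ hψ
  | zero_left ψ => simpa using LinearMap.congr_fun (smul_left 0 0 ψ) z
  | zero_right φ => simpa using LinearMap.congr_fun (smul_right 0 φ 0) z
  | add_left _ _ _ _ _ _ h₁ h₂ => simp [add_left, h₁, h₂]
  | add_right _ _ _ _ _ _ h₁ h₂ => simp [add_right, h₁, h₂]
  | smul_left _ _ _ _ _ h => simp [smul_left, h]
  | smul_right _ _ _ _ _ h => simp [smul_right, h]

theorem map_mem_range_mapIncl {HA HB : Type*} [AddCommGroup HA] [Module ℂ HA]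
    [AddCommGroup HB] [Module ℂ HB] {KA : Submodule ℂ HA} {KB : Submodule ℂ HB}
    {f : HA →ₗ[ℂ] HA} {g : HB →ₗ[ℂ] HB} (hf : ∀ x, f x ∈ KA) (hg : ∀ y, g y ∈ KB)
    (z : HA ⊗[ℂ] HB) :
    TensorProduct.map f g z ∈ LinearMap.range (TensorProduct.mapIncl KA KB) := by
  refine ⟨TensorProduct.map (f.codRestrict KA hf) (g.codRestrict KB hg) z, ?_⟩
  rw [TensorProduct.mapIncl, ← LinearMap.comp_apply, ← TensorProduct.map_comp]
  simp

/-- **Kernel of the restriction map to a product `Λ₁ × Λ₂` (linear-algebraic form).**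
With `H_A` a finite-dimensional complex vector space, `H_B` a finite-dimensional complex
inner product space, `Φ`, `Ψ` nonempty sets of functionals on `H_A`, `H_B` respectively,
`K_A = ⋂_{φ ∈ Φ} ker φ` and `K_B = ⋂_{ψ ∈ Ψ} ker ψ`, one has
`⋂_{φ ∈ Φ, ψ ∈ Ψ} ker (φ ⊗ ψ) = (H_A ⊗ K_B) ⊔ (K_A ⊗ K_Bᗮ)`, a direct sum. -/
theorem ker_tensorFunctional_product
    {HA HB : Type*} [AddCommGroup HA] [Module ℂ HA] [FiniteDimensional ℂ HA]
    [NormedAddCommGroup HB] [InnerProductSpace ℂ HB] [FiniteDimensional ℂ HB]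
    (Φ : Set (HA →ₗ[ℂ] ℂ)) (hΦ : Φ.Nonempty)
    (Ψ : Set (HB →ₗ[ℂ] ℂ)) (hΨ : Ψ.Nonempty)
    (KA : Submodule ℂ HA) (hKA : KA = ⨅ φ ∈ Φ, LinearMap.ker φ)
    (KB : Submodule ℂ HB) (hKB : KB = ⨅ ψ ∈ Ψ, LinearMap.ker ψ) :
    (⨅ φ ∈ Φ, ⨅ ψ ∈ Ψ, LinearMap.ker (tensorFunctional φ ψ)) =
        LinearMap.range (TensorProduct.mapIncl (⊤ : Submodule ℂ HA) KB) ⊔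
          LinearMap.range (TensorProduct.mapIncl KA KBᗮ) ∧
      LinearMap.range (TensorProduct.mapIncl (⊤ : Submodule ℂ HA) KB) ⊓
          LinearMap.range (TensorProduct.mapIncl KA KBᗮ) = ⊥ := by
  let P : HB →ₗ[ℂ] HB := KBᗮ.starProjection.toLinearMap
  have hP (y : HB) : P y ∈ KBᗮ := KBᗮ.starProjection_apply_mem y
  have hQ (y : HB) : (LinearMap.id - P : HB →ₗ[ℂ] HB) y ∈ KB := by
    simp [P, Submodule.starProjection_orthogonal_val]
  have hPK (y : HB) (hy : y ∈ KB) : P y = 0 := by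
    simp [P, Submodule.starProjection_orthogonal_val,
      Submodule.starProjection_eq_self_iff.2 hy]
  have hPK' (y : HB) (hy : y ∈ KBᗮ) : P y = y := Submodule.starProjection_eq_self_iff.2 hy
  obtain ⟨r, hr⟩ := KA.subtype.exists_leftInverse_of_injective KA.ker_subtype
  let R : HA →ₗ[ℂ] HA := KA.subtype ∘ₗ r
  have hR (x : HA) : R x ∈ KA := (r x).2
  have hRK (x : HA) (hx : x ∈ KA) : R x = x :=
    congrArg Subtype.val (LinearMap.congr_fun hr ⟨x, hx⟩)
  refine ⟨le_antisymm (fun z hz => ?_) (sup_le ?_ ?_), ?_⟩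
  · simp only [Submodule.mem_iInf, LinearMap.mem_ker] at hz
    have hzero : TensorProduct.map (LinearMap.id - R) P z = 0 := by
      refine eq_zero_of_forall_tensorFunctional _ fun α β => ?_
      rw [tensorFunctional_map]
      refine tensorFunctional_eq_zero_of_mem_span hz
        (mem_span_of_iInf_ker_le Φ _ ?_) (mem_span_of_iInf_ker_le Ψ _ ?_)
      · rw [← hKA]
        exact fun x hx => by simp [hRK x hx]
      · rw [← hKB]
        exact fun y hy => by simp [hPK y hy]
    have hdecomp : z = TensorProduct.map LinearMap.id (LinearMap.id - P) z +
        TensorProduct.map R P z := by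
      have hsum : LinearMap.id = TensorProduct.map LinearMap.id (LinearMap.id - P) +
          TensorProduct.map R P + TensorProduct.map (LinearMap.id - R) P := by
        ext x y
        simp [TensorProduct.tmul_sub, TensorProduct.sub_tmul]
      simpa [hzero] using LinearMap.congr_fun hsum z
    rw [hdecomp]
    exact Submodule.add_mem_sup (map_mem_range_mapIncl (fun _ => Submodule.mem_top) hQ z)
      (map_mem_range_mapIncl hR hP z)
  · simp only [le_iInf_iff, LinearMap.range_le_ker_iff]
    intro φ _ ψ hψ
    ext x y
    have hy : ψ y = 0 := by
      have := hKB.le y.2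
      simp only [Submodule.mem_iInf, LinearMap.mem_ker] at this
      exact this ψ hψ
    simp [TensorProduct.mapIncl, tensorFunctional_tmul, hy]
  · simp only [le_iInf_iff, LinearMap.range_le_ker_iff]
    intro φ hφ ψ _
    ext x y
    have hx : φ x = 0 := by
      have := hKA.le x.2
      simp only [Submodule.mem_iInf, LinearMap.mem_ker] at this
      exact this φ hφ
    simp [TensorProduct.mapIncl, tensorFunctional_tmul, hx]
  · rw [Submodule.eq_bot_iff]
    rintro z ⟨⟨s, rfl⟩, ⟨t, ht⟩⟩
    have hs : TensorProduct.map LinearMap.id P ∘ₗ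
        TensorProduct.mapIncl (⊤ : Submodule ℂ HA) KB = 0 := by
      ext x y
      simp [TensorProduct.mapIncl, hPK]
    have ht' : TensorProduct.map LinearMap.id P ∘ₗ TensorProduct.mapIncl KA KBᗮ =
        TensorProduct.mapIncl KA KBᗮ := by
      ext x y
      simp [TensorProduct.mapIncl, hPK']
    rw [← ht, ← ht', LinearMap.comp_apply, ht]
    exact LinearMap.congr_fun hs s
end

section
/- Let H_A and H_B be finite-dimensional complex inner product spaces, Φ a nonempty set of linear functionals on H_A and Ψ a nonempty set of linear functionals on H_B. Set K_A = ⋂_{φ∈Φ} ker(φ) and K_B = ⋂_{ψ∈Ψ} ker(ψ), and let N = ⋂_{φ∈Φ, ψ∈Ψ} ker(φ ⊗ ψ) ≤ H_A ⊗[ℂ] H_B. Then the subspace K_Aᗮ ⊗ K_Bᗮ is a linear complement of N in H_A ⊗[ℂ] H_B: N ⊔ (K_Aᗮ ⊗ K_Bᗮ) = H_A ⊗[ℂ] H_B and N ⊓ (K_Aᗮ ⊗ K_Bᗮ) = {0}. -/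
open TensorProduct

section Functionals

variable {V W V' W' : Type*}
  [AddCommGroup V] [Module ℂ V] [AddCommGroup W] [Module ℂ W]
  [AddCommGroup V'] [Module ℂ V'] [AddCommGroup W'] [Module ℂ W']

@[simp]
lemma tensorFunctional_tmul_s5 (φ : V →ₗ[ℂ] ℂ) (ψ : W →ₗ[ℂ] ℂ) (v : V) (w : W) :
    tensorFunctional φ ψ (v ⊗ₜ[ℂ] w) = φ v * ψ w := by
  simp [tensorFunctional]

lemma tensorFunctional_comp_map (f : V' →ₗ[ℂ] ℂ) (g : W' →ₗ[ℂ] ℂ)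
    (p : V →ₗ[ℂ] V') (q : W →ₗ[ℂ] W') :
    tensorFunctional f g ∘ₗ TensorProduct.map p q = tensorFunctional (f ∘ₗ p) (g ∘ₗ q) :=
  TensorProduct.ext' fun v w => by simp

lemma tensorFunctional_eq_dualDistrib (φ : V →ₗ[ℂ] ℂ) (ψ : W →ₗ[ℂ] ℂ) :
    tensorFunctional φ ψ = dualDistrib ℂ V W (φ ⊗ₜ[ℂ] ψ) :=
  TensorProduct.ext' fun v w => by simp [dualDistrib_apply]

lemma eq_zero_of_forall_tensorFunctional_eq_zero {x : V ⊗[ℂ] W}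
    (h : ∀ f g, tensorFunctional f g x = 0) : x = 0 := by
  let b := Module.Basis.ofVectorSpace ℂ V
  let c := Module.Basis.ofVectorSpace ℂ W
  refine (b.tensorProduct c).ext_elem fun ij => ?_
  have key : tensorFunctional (b.coord ij.1) (c.coord ij.2) = (b.tensorProduct c).coord ij :=
    TensorProduct.ext' fun v w => by
      rw [tensorFunctional_tmul_s5, Module.Basis.coord_apply, Module.Basis.coord_apply,
        Module.Basis.coord_apply, Module.Basis.tensorProduct_repr_tmul_apply, smul_eq_mul,
        mul_comm]
  rw [← Module.Basis.coord_apply, ← key, h, map_zero, Finsupp.zero_apply]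

lemma tensorFunctional_eq_zero_of_mem_span_s5 {Φ : Set (V →ₗ[ℂ] ℂ)} {Ψ : Set (W →ₗ[ℂ] ℂ)}
    {x : V ⊗[ℂ] W} (h : ∀ φ ∈ Φ, ∀ ψ ∈ Ψ, tensorFunctional φ ψ x = 0)
    {φ : V →ₗ[ℂ] ℂ} (hφ : φ ∈ Submodule.span ℂ Φ)
    {ψ : W →ₗ[ℂ] ℂ} (hψ : ψ ∈ Submodule.span ℂ Ψ) : tensorFunctional φ ψ x = 0 := by
  simp only [tensorFunctional_eq_dualDistrib] at h ⊢
  induction hφ, hψ using Submodule.span_induction₂ with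
  | mem_mem φ ψ hφ hψ => exact h φ hφ ψ hψ
  | zero_left => simp
  | zero_right => simp
  | add_left _ _ _ _ _ _ h₁ h₂ => simp [add_tmul, h₁, h₂]
  | add_right _ _ _ _ _ _ h₁ h₂ => simp [tmul_add, h₁, h₂]
  | smul_left _ _ _ _ _ h₁ => simp [← smul_tmul', h₁]
  | smul_right _ _ _ _ _ h₁ => simp [h₁]

lemma span_eq_dualAnnihilator_iInf_ker [FiniteDimensional ℂ V] (Φ : Set (V →ₗ[ℂ] ℂ)) :
    Submodule.span ℂ Φ = (⨅ φ ∈ Φ, LinearMap.ker φ).dualAnnihilator := by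
  have : (⨅ φ ∈ Φ, LinearMap.ker φ) = (Submodule.span ℂ Φ).dualCoannihilator := by
    ext v
    rw [← SetLike.mem_coe (p := (Submodule.span ℂ Φ).dualCoannihilator),
      Submodule.coe_dualCoannihilator_span]
    simp [Submodule.mem_iInf]
  rw [this, Subspace.dualCoannihilator_dualAnnihilator_eq]

/-- The common kernel of the functionals `φ ⊗ ψ` is the kernel of `p ⊗ q`, for any linear maps
`p`, `q` whose kernels are the common kernels of `Φ` and of `Ψ`. -/
lemma iInf_ker_tensorFunctional_eq_ker_map [FiniteDimensional ℂ V] [FiniteDimensional ℂ W]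
    {Φ : Set (V →ₗ[ℂ] ℂ)} {Ψ : Set (W →ₗ[ℂ] ℂ)} {p : V →ₗ[ℂ] V'} {q : W →ₗ[ℂ] W'}
    (hp : LinearMap.ker p = ⨅ φ ∈ Φ, LinearMap.ker φ)
    (hq : LinearMap.ker q = ⨅ ψ ∈ Ψ, LinearMap.ker ψ) :
    ⨅ φ ∈ Φ, ⨅ ψ ∈ Ψ, LinearMap.ker (tensorFunctional φ ψ) =
      LinearMap.ker (TensorProduct.map p q) := by
  have hΦ : Submodule.span ℂ Φ = LinearMap.range p.dualMap := by
    rw [span_eq_dualAnnihilator_iInf_ker, ← hp, LinearMap.range_dualMap_eq_dualAnnihilator_ker]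
  have hΨ : Submodule.span ℂ Ψ = LinearMap.range q.dualMap := by
    rw [span_eq_dualAnnihilator_iInf_ker, ← hq, LinearMap.range_dualMap_eq_dualAnnihilator_ker]
  ext x
  simp only [Submodule.mem_iInf, LinearMap.mem_ker]
  refine ⟨fun h => eq_zero_of_forall_tensorFunctional_eq_zero fun f g => ?_,
    fun h φ hφ ψ hψ => ?_⟩
  · rw [← LinearMap.comp_apply, tensorFunctional_comp_map]
    exact tensorFunctional_eq_zero_of_mem_span_s5 h (hΦ ▸ ⟨f, rfl⟩) (hΨ ▸ ⟨g, rfl⟩)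
  · obtain ⟨f, rfl⟩ := hΦ ▸ Submodule.subset_span hφ
    obtain ⟨g, rfl⟩ := hΨ ▸ Submodule.subset_span hψ
    rw [LinearMap.dualMap_apply', LinearMap.dualMap_apply', ← tensorFunctional_comp_map,
      LinearMap.comp_apply, h, map_zero]

end Functionals

/-- **`K_Aᗮ ⊗ K_Bᗮ` is a linear complement of the kernel of the restriction map.**
With `H_A`, `H_B` finite-dimensional complex inner product spaces, `Φ`, `Ψ` nonempty sets
of functionals, `K_A = ⋂_{φ ∈ Φ} ker φ`, `K_B = ⋂_{ψ ∈ Ψ} ker ψ`, and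
`N = ⋂_{φ ∈ Φ, ψ ∈ Ψ} ker (φ ⊗ ψ)`, one has `N ⊔ (K_Aᗮ ⊗ K_Bᗮ) = ⊤` and
`N ⊓ (K_Aᗮ ⊗ K_Bᗮ) = ⊥`. -/
theorem ker_tensorFunctional_compl
    {HA HB : Type*}
    [NormedAddCommGroup HA] [InnerProductSpace ℂ HA] [FiniteDimensional ℂ HA]
    [NormedAddCommGroup HB] [InnerProductSpace ℂ HB] [FiniteDimensional ℂ HB]
    (Φ : Set (HA →ₗ[ℂ] ℂ)) (hΦ : Φ.Nonempty)
    (Ψ : Set (HB →ₗ[ℂ] ℂ)) (hΨ : Ψ.Nonempty)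
    (KA : Submodule ℂ HA) (hKA : KA = ⨅ φ ∈ Φ, LinearMap.ker φ)
    (KB : Submodule ℂ HB) (hKB : KB = ⨅ ψ ∈ Ψ, LinearMap.ker ψ)
    (N : Submodule ℂ (HA ⊗[ℂ] HB))
    (hN : N = ⨅ φ ∈ Φ, ⨅ ψ ∈ Ψ, LinearMap.ker (tensorFunctional φ ψ)) :
    N ⊔ LinearMap.range (TensorProduct.mapIncl KAᗮ KBᗮ) = ⊤ ∧
      N ⊓ LinearMap.range (TensorProduct.mapIncl KAᗮ KBᗮ) = ⊥ := by
  have hp : LinearMap.ker (KAᗮ.starProjection : HA →ₗ[ℂ] HA) = ⨅ φ ∈ Φ, LinearMap.ker φ := by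
    rw [← hKA, Submodule.ker_starProjection, Submodule.orthogonal_orthogonal]
  have hq : LinearMap.ker (KBᗮ.starProjection : HB →ₗ[ℂ] HB) = ⨅ ψ ∈ Ψ, LinearMap.ker ψ := by
    rw [← hKB, Submodule.ker_starProjection, Submodule.orthogonal_orthogonal]
  have hrange : LinearMap.range (TensorProduct.mapIncl KAᗮ KBᗮ) =
      LinearMap.range (TensorProduct.map (KAᗮ.starProjection : HA →ₗ[ℂ] HA)
        (KBᗮ.starProjection : HB →ₗ[ℂ] HB)) := by
    rw [range_mapIncl, range_map, Submodule.range_starProjection, Submodule.range_starProjection]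
  have hidem : IsIdempotentElem (TensorProduct.map (KAᗮ.starProjection : HA →ₗ[ℂ] HA)
      (KBᗮ.starProjection : HB →ₗ[ℂ] HB)) :=
    (TensorProduct.map_mul _ _ _ _).symm.trans <| congrArg₂ TensorProduct.map
      (ContinuousLinearMap.IsIdempotentElem.toLinearMap KAᗮ.isIdempotentElem_starProjection)
      (ContinuousLinearMap.IsIdempotentElem.toLinearMap KBᗮ.isIdempotentElem_starProjection)
  have hcompl := (LinearMap.IsIdempotentElem.isCompl hidem).symm
  rw [hN, iInf_ker_tensorFunctional_eq_ker_map hp hq, hrange]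
  exact ⟨hcompl.sup_eq_top, hcompl.inf_eq_bot⟩
end
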